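/- For every real number α with 0 < α < 1 and all real numbers A, B > 0, one has (A + B)^α ≤ A^α + B^α − ((1 − α)/2^{α+1}) · min{A^α, B^α}. -/

import Mathlib

/-- A concave function on `[0, ∞)` has decreasing increments: the increment of length `a` at `b`
is at most the one at `a` when `a ≤ b`. -/
lemma ConcaveOn.add_le_add_two_mul {f : ℝ → ℝ} (hf : ConcaveOn ℝ (Set.Ici 0) f) {a b : ℝ}
    (ha : 0 < a) (hab : a ≤ b) : f (a + b) + f a ≤ f (2 * a) + f b := by
  have hb : 0 < b := ha.trans_le hab
  have hw : 0 ≤ a / b := by positivity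
  have hw' : 0 ≤ 1 - a / b := sub_nonneg.2 ((div_le_one hb).2 hab)
  have h₁ := hf.2 (Set.mem_Ici.2 ha.le) (Set.mem_Ici.2 (add_pos ha hb).le) hw' hw (by ring)
  have h₂ := hf.2 (Set.mem_Ici.2 ha.le) (Set.mem_Ici.2 (add_pos ha hb).le) hw hw' (by ring)
  simp only [smul_eq_mul] at h₁ h₂
  rw [show (1 - a / b) * a + a / b * (a + b) = 2 * a by field_simp; ring] at h₁
  rw [show a / b * a + (1 - a / b) * (a + b) = b by field_simp; ring] at h₂
  linarith

lemma Real.add_rpow_le_of_le {α a b : ℝ} (hα₀ : 0 < α) (hα₁ : α < 1) (ha : 0 < a)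
    (hab : a ≤ b) :
    (a + b) ^ α ≤ a ^ α + b ^ α - (1 - α) / 2 ^ (α + 1) * a ^ α := by
  have hc := (Real.concaveOn_rpow hα₀.le hα₁.le).add_le_add_two_mul ha hab
  rw [Real.mul_rpow zero_le_two ha.le] at hc
  have hbern : (2 : ℝ) ^ α ≤ 1 + α := by
    have h := rpow_one_add_le_one_add_mul_self (s := 1) (by norm_num) hα₀.le hα₁.le
    norm_num at h
    exact h
  have hdiv : (1 - α) / 2 ^ (α + 1) ≤ 1 - α :=
    div_le_self (sub_nonneg.2 hα₁.le) (Real.one_le_rpow one_le_two (by linarith))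
  have := mul_le_mul_of_nonneg_right (add_le_add hbern hdiv) (Real.rpow_nonneg ha.le α)
  linarith

/-- Quantitative subadditivity of concave powers: for `0 < α < 1` and `A, B > 0`,
`(A + B)^α ≤ A^α + B^α - (1-α)/2^(α+1) * min(A^α, B^α)`. -/
theorem quantitative_subadditivity_of_concave_powers
    (α A B : ℝ) (hα₀ : 0 < α) (hα₁ : α < 1) (hA : 0 < A) (hB : 0 < B) :
    (A + B) ^ α ≤ A ^ α + B ^ α - (1 - α) / 2 ^ (α + 1) * min (A ^ α) (B ^ α) := by
  rcases le_total A B with h | h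
  · rw [min_eq_left (Real.rpow_le_rpow hA.le h hα₀.le)]
    exact Real.add_rpow_le_of_le hα₀ hα₁ hA h
  · rw [min_eq_right (Real.rpow_le_rpow hB.le h hα₀.le), add_comm A B, add_comm (A ^ α)]
    exact Real.add_rpow_le_of_le hα₀ hα₁ hB h
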